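/- arXiv:2105.06686 — 5 statements merged into one kernel-verified Lean document; each statement's English description precedes it below -/
import Mathlib

section
/- Let G = (A, Σ₁, Σ₂) be a timed game with priority function p : L → {0,…,d−1} and bound λ ∈ ℕ∖{0}. For every infinite play π = (ℓ_0,ν_0)(m_0^(1),m_0^(2))(ℓ_1,ν_1)… of G and every n ∈ ℕ with step delay d_n: the suffix π_{n→} belongs to TGW(p,λ) if and only if for all d ∈ [0,d_n] the delayed suffix π_{n→}^{+d} belongs to TGW(p,λ). Consequently, π ∈ DTW(p,λ) if and only if for all n ∈ ℕ, π_{n→} ∈ TGW(p,λ). -/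
open scoped NNReal

namespace TWPaper

variable {L C Act : Type}

/-- Comparison operators appearing in clock constraints. -/
inductive Cmp where
  | le | ge | lt | gt

/-- An atomic clock constraint `x ∼ c` with `c : ℕ`. -/
structure Atom (C : Type) where
  clock : C
  cmp : Cmp
  bound : ℕ

/-- Clock valuations. -/
abbrev Val (C : Type) := C → ℝ≥0

def Atom.sat (ν : Val C) (a : Atom C) : Prop :=
  match a.cmp with
  | Cmp.le => ν a.clock ≤ (a.bound : ℝ≥0)
  | Cmp.ge => (a.bound : ℝ≥0) ≤ ν a.clock
  | Cmp.lt => ν a.clock < (a.bound : ℝ≥0)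
  | Cmp.gt => (a.bound : ℝ≥0) < ν a.clock

/-- A clock constraint: a finite conjunction of atomic constraints. -/
abbrev ClockConstraint (C : Type) := List (Atom C)

def satCC (ν : Val C) (g : ClockConstraint C) : Prop := ∀ a ∈ g, a.sat ν

/-- Let `d` time units pass. -/
def shift (ν : Val C) (d : ℝ≥0) : Val C := fun x => ν x + d

open Classical in
/-- Reset the clocks in `D` to `0`. -/
noncomputable def resetV (D : Set C) (ν : Val C) : Val C :=
  fun x => if x ∈ D then 0 else ν x

structure Edge (L C Act : Type) where
  src : L
  guard : ClockConstraint C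
  act : Act
  resets : Set C
  tgt : L

/-- A timed automaton. -/
structure TA (L C Act : Type) where
  init : L
  gamma : C
  inv : L → ClockConstraint C
  edges : Set (Edge L C Act)

/-- Well-formedness of a timed automaton: the special global clock `γ` is never
reset, and no two edges from the same location sharing an action have
simultaneously satisfiable guards (determinism). -/
def TA.WellFormed (A : TA L C Act) : Prop :=
  (∀ e ∈ A.edges, A.gamma ∉ e.resets) ∧
  (∀ e₁ ∈ A.edges, ∀ e₂ ∈ A.edges, e₁.src = e₂.src → e₁.act = e₂.act →
    (∃ ν : Val C, satCC ν e₁.guard ∧ satCC ν e₂.guard) → e₁ = e₂)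

/-- A move: a delay together with an action (`none` is the special delay action `⊥`). -/
abbrev Mv (Act : Type) := ℝ≥0 × Option Act

/-- The transition relation of the transition system of a timed automaton. -/
def TA.Trans (A : TA L C Act) (s : L × Val C) (m : Mv Act) (s' : L × Val C) : Prop :=
  satCC (shift s.2 m.1) (A.inv s.1) ∧
  (match m.2 with
   | none => s'.1 = s.1 ∧ s'.2 = shift s.2 m.1
   | some a => ∃ e ∈ A.edges, e.src = s.1 ∧ e.act = a ∧
       satCC (shift s.2 m.1) e.guard ∧ s'.1 = e.tgt ∧
       s'.2 = resetV e.resets (shift s.2 m.1) ∧ satCC s'.2 (A.inv e.tgt))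

/-- An infinite path of a timed automaton (the underlying data). -/
structure RawPath (L C Act : Type) where
  s : ℕ → L × Val C
  m : ℕ → Mv Act

def TA.IsPath (A : TA L C Act) (π : RawPath L C Act) : Prop :=
  ∀ n, A.Trans (π.s n) (π.m n) (π.s (n + 1))

/-- A timed game: a timed automaton together with a partition of the actions;
`isP1 a` means that `a` is a player-1 action (its complement is player 2's set). -/
structure TG (L C Act : Type) where
  ta : TA L C Act
  isP1 : Act → Prop

/-- Moves available to player 1 in state `s`. -/
def TG.Move1 (G : TG L C Act) (s : L × Val C) (m : Mv Act) : Prop :=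
  (∀ a, m.2 = some a → G.isP1 a) ∧ ∃ s', G.ta.Trans s m s'

/-- Moves available to player 2 in state `s`. -/
def TG.Move2 (G : TG L C Act) (s : L × Val C) (m : Mv Act) : Prop :=
  (∀ a, m.2 = some a → ¬ G.isP1 a) ∧ ∃ s', G.ta.Trans s m s'

/-- An infinite play of a timed game (the underlying data). -/
structure RawPlay (L C Act : Type) where
  s : ℕ → L × Val C
  m1 : ℕ → Mv Act
  m2 : ℕ → Mv Act

/-- The delay at step `n`: the minimum of the delays of the two chosen moves. -/
def RawPlay.delay (π : RawPlay L C Act) (n : ℕ) : ℝ≥0 := min (π.m1 n).1 (π.m2 n).1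

/-- The play obtained by removing the first `n` steps. -/
def RawPlay.drop (π : RawPlay L C Act) (n : ℕ) : RawPlay L C Act :=
  ⟨fun k => π.s (n + k), fun k => π.m1 (n + k), fun k => π.m2 (n + k)⟩

/-- The joint destination relation: the fastest move is carried out,
nondeterministically so in case of a tie. -/
def TG.JointDest (G : TG L C Act) (s : L × Val C) (m₁ m₂ : Mv Act) (s' : L × Val C) : Prop :=
  (m₁.1 < m₂.1 ∧ G.ta.Trans s m₁ s') ∨ (m₂.1 < m₁.1 ∧ G.ta.Trans s m₂ s') ∨
  (m₁.1 = m₂.1 ∧ (G.ta.Trans s m₁ s' ∨ G.ta.Trans s m₂ s'))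

def TG.StepOK (G : TG L C Act) (π : RawPlay L C Act) (n : ℕ) : Prop :=
  G.Move1 (π.s n) (π.m1 n) ∧ G.Move2 (π.s n) (π.m2 n) ∧
  G.JointDest (π.s n) (π.m1 n) (π.m2 n) (π.s (n + 1))

def TG.IsPlay (G : TG L C Act) (π : RawPlay L C Act) : Prop := ∀ n, G.StepOK π n

/-- `π` is a valid play for its first `n` steps (i.e., viewed as a finite play
consisting of `n` moves). -/
def TG.IsPlayUpTo (G : TG L C Act) (π : RawPlay L C Act) (n : ℕ) : Prop :=
  ∀ k < n, G.StepOK π k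

/-- The state/delay sequence of a play or path.  All the objectives considered
are state-based and are therefore defined on traces. -/
structure Trace (L C : Type) where
  st : ℕ → L × Val C
  dl : ℕ → ℝ≥0

def RawPlay.trace (π : RawPlay L C Act) : Trace L C := ⟨π.s, fun n => π.delay n⟩
def RawPath.trace (π : RawPath L C Act) : Trace L C := ⟨π.s, fun n => (π.m n).1⟩

/-- The delayed suffix `π_{n→}^{+d}`. -/
noncomputable def Trace.delayedSuffix (τ : Trace L C) (n : ℕ) (d : ℝ≥0) : Trace L C where
  st := fun k => if k = 0 then ((τ.st n).1, shift (τ.st n).2 d) else τ.st (n + k)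
  dl := fun k => if k = 0 then τ.dl n - d else τ.dl (n + k)

/-- The suffix `π_{n→} = π_{n→}^{+0}`. -/
noncomputable def Trace.suffix (τ : Trace L C) (n : ℕ) : Trace L C := τ.delayedSuffix n 0

/-- `min_{a ≤ k ≤ b} p(ℓ_k)`. -/
noncomputable def minPrioIcc (p : L → ℕ) (τ : Trace L C) (a b : ℕ) : ℕ :=
  sInf ((fun k => p (τ.st k).1) '' Set.Icc a b)

/-- The timed good window objective `TGW(p, λ)`. -/
def TGW (γ : C) (p : L → ℕ) (lam : ℕ) : Set (Trace L C) :=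
  {τ | ∃ j : ℕ, Even (minPrioIcc p τ 0 j) ∧ (τ.st j).2 γ - (τ.st 0).2 γ < (lam : ℝ≥0)}

/-- The direct timed window parity objective `DTW(p, λ)`. -/
def DTW (γ : C) (p : L → ℕ) (lam : ℕ) : Set (Trace L C) :=
  {τ | ∀ n : ℕ, ∀ d : ℝ≥0, d ≤ τ.dl n → τ.delayedSuffix n d ∈ TGW γ p lam}

/-- The timed window parity objective `TW(p, λ)`. -/
def TW (γ : C) (p : L → ℕ) (lam : ℕ) : Set (Trace L C) :=
  {τ | ∃ n : ℕ, τ.suffix n ∈ DTW γ p lam}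

/-- Time divergence: the global clock `γ` is unbounded along the trace. -/
def TimeDiv (γ : C) (τ : Trace L C) : Prop := ∀ B : ℝ≥0, ∃ j, B < (τ.st j).2 γ

/-- The parity objective: the least priority seen infinitely often is even. -/
def ParityObj (p : L → ℕ) : Set (Trace L C) :=
  {τ | Even (Filter.liminf (fun n => p (τ.st n).1) Filter.atTop)}

/-- The safety objective for the set `F` of locations. -/
def SafeObj (F : Set L) : Set (Trace L C) := {τ | ∀ n, (τ.st n).1 ∉ F}

/-- The co-Büchi objective for the set `F` of locations. -/
def CoBuchiObj (F : Set L) : Set (Trace L C) := {τ | ∃ N, ∀ n ≥ N, (τ.st n).1 ∉ F}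

/-! ### The expanded timed automaton (one dimension) -/

/-- Locations of the expanded automaton: `(ℓ, some q)` carries the priority `q`
of the current window, `(ℓ, none)` is the bad location `(ℓ, bad)`. -/
abbrev ExpLoc (L : Type) := L × Option ℕ
/-- Clocks of the expanded automaton: `none` is the fresh clock `z`. -/
abbrev ExpClock (C : Type) := Option C
/-- Actions of the expanded automaton: `Sum.inr true = β₁` and `Sum.inr false = β₂`. -/
abbrev ExpAct (Act : Type) := Act ⊕ Bool

def liftAtom {C C' : Type} (f : C → C') (a : Atom C) : Atom C' := ⟨f a.clock, a.cmp, a.bound⟩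

def liftCC {C C' : Type} (f : C → C') (g : ClockConstraint C) : ClockConstraint C' :=
  g.map (liftAtom f)

/-- The expanded timed automaton `A(p, λ)`, where the priorities used range over
`{0, …, d-1}`. -/
def expTA (A : TA L C Act) (d : ℕ) (p : L → ℕ) (lam : ℕ) :
    TA (ExpLoc L) (ExpClock C) (ExpAct Act) where
  init := (A.init, some (p A.init))
  gamma := some A.gamma
  inv := fun lq =>
    match lq.2 with
    | some q => liftCC some (A.inv lq.1) ++
        (if q % 2 = 1 then [⟨none, Cmp.le, lam⟩] else [])
    | none => [⟨none, Cmp.le, 0⟩, ⟨none, Cmp.ge, 0⟩]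
  edges :=
    {e : Edge (ExpLoc L) (ExpClock C) (ExpAct Act) |
      ∃ q < d, q % 2 = 0 ∧ ∃ e₀ ∈ A.edges,
        e = ⟨(e₀.src, some q), liftCC some e₀.guard, Sum.inl e₀.act,
             (Option.some '' e₀.resets) ∪ {none}, (e₀.tgt, some (p e₀.tgt))⟩} ∪
    {e : Edge (ExpLoc L) (ExpClock C) (ExpAct Act) |
      ∃ q < d, q % 2 = 1 ∧ ∃ e₀ ∈ A.edges,
        e = ⟨(e₀.src, some q), liftCC some e₀.guard ++ [⟨none, Cmp.lt, lam⟩],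
             Sum.inl e₀.act, Option.some '' e₀.resets,
             (e₀.tgt, some (min q (p e₀.tgt)))⟩} ∪
    {e : Edge (ExpLoc L) (ExpClock C) (ExpAct Act) |
      ∃ q < d, q % 2 = 1 ∧ ∃ (ℓ : L) (b : Bool),
        e = ⟨(ℓ, some q), [⟨none, Cmp.le, lam⟩, ⟨none, Cmp.ge, lam⟩], Sum.inr b,
             {none}, (ℓ, none)⟩} ∪
    {e : Edge (ExpLoc L) (ExpClock C) (ExpAct Act) |
      ∃ (ℓ : L) (b : Bool), e = ⟨(ℓ, none), [], Sum.inr b, ∅, (ℓ, some (p ℓ))⟩}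

/-- The expanded timed game `G(p, λ)`: `β₁` belongs to player 1, `β₂` to player 2. -/
def expTG (G : TG L C Act) (d : ℕ) (p : L → ℕ) (lam : ℕ) :
    TG (ExpLoc L) (ExpClock C) (ExpAct Act) :=
  ⟨expTA G.ta d p lam,
   fun a => match a with | Sum.inl a => G.isP1 a | Sum.inr b => b = true⟩

/-- The set `Bad = L × {bad}` of bad locations. -/
def BadLocs (L : Type) : Set (ExpLoc L) := {lq | lq.2 = none}

/-! ### The projection mapping -/

def projMove (m : Mv (ExpAct Act)) : Mv Act :=
  (m.1, match m.2 with
        | some (Sum.inl a) => some a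
        | some (Sum.inr _) => none
        | none => none)

def projState (s : ExpLoc L × Val (ExpClock C)) : L × Val C :=
  (s.1.1, fun c => s.2 (some c))

/-- The projection mapping `Pr`. -/
def projPlay (π : RawPlay (ExpLoc L) (ExpClock C) (ExpAct Act)) : RawPlay L C Act :=
  ⟨fun n => projState (π.s n), fun n => projMove (π.m1 n), fun n => projMove (π.m2 n)⟩

/-- A play of the expanded game is well-initialized if `q₀ = p(ℓ₀)` and `ν₀(z) = 0`. -/
def WellInit (p : L → ℕ) (π : RawPlay (ExpLoc L) (ExpClock C) (ExpAct Act)) : Prop :=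
  (π.s 0).1.2 = some (p (π.s 0).1.1) ∧ (π.s 0).2 none = 0

/-! ### The expansion mapping -/

def liftMove (m : Mv Act) : Mv (ExpAct Act) := (m.1, m.2.map Sum.inl)

def betaMv {Act : Type} (b : Bool) (t : ℝ≥0) : Mv (ExpAct Act) := (t, some (Sum.inr b))

/-- The conditions relating step `n` of a play `π` of `G` to the segment
`[f n, f (n+1)]` of its expansion `π'`, following the inductive definition of
the expansion mapping `Ex`. -/
def ExStep (p : L → ℕ) (lam : ℕ) (π : RawPlay L C Act)
    (π' : RawPlay (ExpLoc L) (ExpClock C) (ExpAct Act)) (f : ℕ → ℕ) (n : ℕ) : Prop :=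
  ∃ q : ℕ, (π'.s (f n)).1.2 = some q ∧
    (∀ z dn : ℝ≥0, z = (π'.s (f n)).2 none → dn = π.delay n →
      -- Cases 1 and 2.a : no bad window is detected during this step
      ((q % 2 = 0 ∨ z + dn < (lam : ℝ≥0)) →
        f (n + 1) = f n + 1 ∧
        (q % 2 = 0 →
          π'.m1 (f n) = liftMove (π.m1 n) ∧ π'.m2 (f n) = liftMove (π.m2 n)) ∧
        (q % 2 = 1 →
          ((z + (π.m1 n).1 < (lam : ℝ≥0) → π'.m1 (f n) = liftMove (π.m1 n)) ∧
           ((lam : ℝ≥0) ≤ z + (π.m1 n).1 →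
              π'.m1 (f n) = betaMv true ((lam : ℝ≥0) - z)) ∧
           (z + (π.m2 n).1 < (lam : ℝ≥0) → π'.m2 (f n) = liftMove (π.m2 n)) ∧
           ((lam : ℝ≥0) ≤ z + (π.m2 n).1 →
              π'.m2 (f n) = betaMv false ((lam : ℝ≥0) - z))))) ∧
      -- Case 2.b : a bad window is detected during this step; the expansion
      -- visits the bad location `μ` times
      (q % 2 = 1 → (lam : ℝ≥0) ≤ z + dn →
        ∃ μ : ℕ, 1 ≤ μ ∧
          (p (π.s n).1 % 2 = 0 → μ = 1) ∧
          (p (π.s n).1 % 2 = 1 →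
            ((μ * lam : ℕ) : ℝ≥0) ≤ z + dn ∧ z + dn < (((μ + 1) * lam : ℕ) : ℝ≥0)) ∧
          f (n + 1) = f n + 2 * μ + 1 ∧
          (∀ k < μ, (π'.s (f n + 2 * k + 1)).1 = ((π.s n).1, none)) ∧
          (∀ k, 1 ≤ k → k ≤ μ →
            (π'.s (f n + 2 * k)).1 = ((π.s n).1, some (p (π.s n).1))) ∧
          π'.m1 (f n) = betaMv true ((lam : ℝ≥0) - z) ∧
          π'.m2 (f n) = betaMv false ((lam : ℝ≥0) - z) ∧
          (∀ k < μ, π'.m1 (f n + 2 * k + 1) = betaMv true 0 ∧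
                    π'.m2 (f n + 2 * k + 1) = betaMv false 0) ∧
          (∀ k, 1 ≤ k → k < μ →
            π'.m1 (f n + 2 * k) = betaMv true (lam : ℝ≥0) ∧
            π'.m2 (f n + 2 * k) = betaMv false (lam : ℝ≥0)) ∧
          (∀ t' : ℝ≥0, t' = ((lam : ℝ≥0) - z) + ((μ - 1 : ℕ) : ℝ≥0) * (lam : ℝ≥0) →
            (((π.m1 n).1 - t' < (lam : ℝ≥0) ∨ p (π.s n).1 % 2 = 0) →
              π'.m1 (f n + 2 * μ) = ((π.m1 n).1 - t', (π.m1 n).2.map Sum.inl)) ∧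
            (¬ ((π.m1 n).1 - t' < (lam : ℝ≥0) ∨ p (π.s n).1 % 2 = 0) →
              π'.m1 (f n + 2 * μ) = betaMv true (lam : ℝ≥0)) ∧
            (((π.m2 n).1 - t' < (lam : ℝ≥0) ∨ p (π.s n).1 % 2 = 0) →
              π'.m2 (f n + 2 * μ) = ((π.m2 n).1 - t', (π.m2 n).2.map Sum.inl)) ∧
            (¬ ((π.m2 n).1 - t' < (lam : ℝ≥0) ∨ p (π.s n).1 % 2 = 0) →
              π'.m2 (f n + 2 * μ) = betaMv false (lam : ℝ≥0)))))

/-- `π'` is the expansion `Ex(π)` of the play `π`, presented relationally: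
`π'` is a play of the expanded game `G(p, λ)`, and there is an alignment
function `f` matching each step of `π` with the corresponding segment of `π'`
according to the inductive definition of the expansion mapping. -/
def IsExpansion (G : TG L C Act) (d : ℕ) (p : L → ℕ) (lam : ℕ)
    (π : RawPlay L C Act) (π' : RawPlay (ExpLoc L) (ExpClock C) (ExpAct Act)) : Prop :=
  (expTG G d p lam).IsPlay π' ∧
  ∃ f : ℕ → ℕ, f 0 = 0 ∧ StrictMono f ∧
    (π'.s 0).1.2 = some (p (π.s 0).1) ∧ (π'.s 0).2 none = 0 ∧
    (∀ n, (π'.s (f n)).1.1 = (π.s n).1 ∧ (π'.s (f n)).1.2 ≠ none ∧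
          (∀ c : C, (π'.s (f n)).2 (some c) = (π.s n).2 c)) ∧
    (∀ n, ExStep p lam π π' f n)

/-- The finite-play version of `IsExpansion`: the first `N` steps of `π'` form
the expansion of the finite play consisting of the first `n` steps of `π`. -/
def IsExpansionUpTo (G : TG L C Act) (d : ℕ) (p : L → ℕ) (lam : ℕ)
    (π : RawPlay L C Act) (π' : RawPlay (ExpLoc L) (ExpClock C) (ExpAct Act))
    (n N : ℕ) : Prop :=
  (expTG G d p lam).IsPlayUpTo π' N ∧
  ∃ f : ℕ → ℕ, f 0 = 0 ∧ StrictMono f ∧ f n = N ∧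
    (π'.s 0).1.2 = some (p (π.s 0).1) ∧ (π'.s 0).2 none = 0 ∧
    (∀ k ≤ n, (π'.s (f k)).1.1 = (π.s k).1 ∧ (π'.s (f k)).1.2 ≠ none ∧
          (∀ c : C, (π'.s (f k)).2 (some c) = (π.s k).2 c)) ∧
    (∀ k < n, ExStep p lam π π' f k)

/-! ### Strategies -/

/-- A strategy: given the length `n` of the history and a play (of which only
the first `n` steps are meaningful), produce a move. -/
abbrev Strategy (L C Act : Type) := ℕ → RawPlay L C Act → Mv Act

/-- A strategy depends only on the (relevant prefix of the) history. -/
def PrefixDep (σ : Strategy L C Act) : Prop :=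
  ∀ n (π π' : RawPlay L C Act), (∀ k ≤ n, π.s k = π'.s k) →
    (∀ k < n, π.m1 k = π'.m1 k ∧ π.m2 k = π'.m2 k) → σ n π = σ n π'

/-- A move-independent strategy: it depends only on the sequence of states. -/
def MoveIndep (σ : Strategy L C Act) : Prop :=
  ∀ n (π π' : RawPlay L C Act), (∀ k ≤ n, π.s k = π'.s k) → σ n π = σ n π'

/-- `σ` is a valid player-1 strategy in `G`. -/
def IsStrategy1 (G : TG L C Act) (σ : Strategy L C Act) : Prop :=
  PrefixDep σ ∧ ∀ n π, G.IsPlayUpTo π n → G.Move1 (π.s n) (σ n π)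

/-- The play `π` is consistent with the player-1 strategy `σ`. -/
def Consistent1 (σ : Strategy L C Act) (π : RawPlay L C Act) : Prop :=
  ∀ n, π.m1 n = σ n π

/-- Player 1 is not responsible for the transition at step `n` of `π`. -/
def NotResp1 (G : TG L C Act) (π : RawPlay L C Act) (n : ℕ) : Prop :=
  (π.m2 n).1 < (π.m1 n).1 ∨
  ((π.m1 n).1 = (π.m2 n).1 ∧ ¬ G.ta.Trans (π.s n) (π.m1 n) (π.s (n + 1)))

/-- A play is `P₁`-blameless if from some step on, player 1 is never
responsible for the transition. -/
def Blameless1 (G : TG L C Act) (π : RawPlay L C Act) : Prop :=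
  ∃ N, ∀ n ≥ N, NotResp1 G π n

/-- `σ` is a winning player-1 strategy from `s0` for the objective `Ψ`:
every consistent play from `s0` is either time-divergent and in `Ψ`, or
time-convergent and `P₁`-blameless. -/
def Winning1 (G : TG L C Act) (σ : Strategy L C Act) (Ψ : Set (Trace L C))
    (s0 : L × Val C) : Prop :=
  IsStrategy1 G σ ∧ ∀ π : RawPlay L C Act, G.IsPlay π → π.s 0 = s0 → Consistent1 σ π →
    (TimeDiv G.ta.gamma π.trace ∧ π.trace ∈ Ψ) ∨
    (¬ TimeDiv G.ta.gamma π.trace ∧ Blameless1 G π)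

/-! ### The multi-dimensional expanded automaton -/

/-- Locations of the multi-dimensional expanded automaton. -/
abbrev MExpLoc (L : Type) (k : ℕ) := L × Option (Fin k → ℕ)
/-- Clocks of the multi-dimensional expanded automaton: `Sum.inr i` is `z_i`. -/
abbrev MExpClock (C : Type) (k : ℕ) := C ⊕ Fin k

/-- The update function for vectors of priorities. -/
def mUp {k : ℕ} (q : Fin k → ℕ) (p : L → Fin k → ℕ) (ℓ : L) : Fin k → ℕ :=
  fun i => if q i % 2 = 1 then min (q i) (p ℓ i) else p ℓ i

/-- The multi-dimensional expanded timed automaton `A(p, λ)` for a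
`k`-dimensional priority function with priorities in `{0, …, d-1}`. -/
def mExpTA (A : TA L C Act) (k d : ℕ) (hk : 0 < k) (p : L → Fin k → ℕ)
    (lam : Fin k → ℕ) : TA (MExpLoc L k) (MExpClock C k) (ExpAct Act) where
  init := (A.init, some (p A.init))
  gamma := Sum.inl A.gamma
  inv := fun lq =>
    match lq.2 with
    | some q => liftCC Sum.inl (A.inv lq.1) ++
        ((List.finRange k).filter (fun i => decide (q i % 2 = 1))).map
          (fun i => ⟨Sum.inr i, Cmp.le, lam i⟩)
    | none => [⟨Sum.inr ⟨0, hk⟩, Cmp.le, 0⟩, ⟨Sum.inr ⟨0, hk⟩, Cmp.ge, 0⟩]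
  edges :=
    {e : Edge (MExpLoc L k) (MExpClock C k) (ExpAct Act) |
      ∃ q : Fin k → ℕ, (∀ i, q i < d) ∧ ∃ e₀ ∈ A.edges,
        e = ⟨(e₀.src, some q),
             liftCC Sum.inl e₀.guard ++
               ((List.finRange k).filter (fun i => decide (q i % 2 = 1))).map
                 (fun i => ⟨Sum.inr i, Cmp.lt, lam i⟩),
             Sum.inl e₀.act,
             (Sum.inl '' e₀.resets) ∪ (Sum.inr '' {i : Fin k | ¬ q i % 2 = 1}),
             (e₀.tgt, some (mUp q p e₀.tgt))⟩} ∪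
    {e : Edge (MExpLoc L k) (MExpClock C k) (ExpAct Act) |
      ∃ q : Fin k → ℕ, (∀ i, q i < d) ∧ ∃ (ℓ : L) (i : Fin k) (b : Bool), q i % 2 = 1 ∧
        e = ⟨(ℓ, some q),
             [⟨Sum.inr i, Cmp.le, lam i⟩, ⟨Sum.inr i, Cmp.ge, lam i⟩] ++
               ((List.finRange k).filter (fun j => decide (j < i ∧ q j % 2 = 1))).map
                 (fun j => ⟨Sum.inr j, Cmp.lt, lam j⟩),
             Sum.inr b, Sum.inr '' (Set.univ : Set (Fin k)), (ℓ, none)⟩} ∪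
    {e : Edge (MExpLoc L k) (MExpClock C k) (ExpAct Act) |
      ∃ (ℓ : L) (b : Bool), e = ⟨(ℓ, none), [], Sum.inr b, ∅, (ℓ, some (p ℓ))⟩}

/-- The multi-dimensional expanded timed game `G(p, λ)`. -/
def mExpTG (G : TG L C Act) (k d : ℕ) (hk : 0 < k) (p : L → Fin k → ℕ)
    (lam : Fin k → ℕ) : TG (MExpLoc L k) (MExpClock C k) (ExpAct Act) :=
  ⟨mExpTA G.ta k d hk p lam,
   fun a => match a with | Sum.inl a => G.isP1 a | Sum.inr b => b = true⟩

/-- The set of bad locations of the multi-dimensional expanded automaton. -/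
def MBadLocs (L : Type) (k : ℕ) : Set (MExpLoc L k) := {lq | lq.2 = none}

/-- The generalized timed window objective `GTW(p, λ)`. -/
def GTW (γ : C) {k : ℕ} (p : L → Fin k → ℕ) (lam : Fin k → ℕ) : Set (Trace L C) :=
  {τ | ∀ i : Fin k, τ ∈ TW γ (fun ℓ => p ℓ i) (lam i)}

/-- The generalized direct timed window objective `GDTW(p, λ)`. -/
def GDTW (γ : C) {k : ℕ} (p : L → Fin k → ℕ) (lam : Fin k → ℕ) : Set (Trace L C) :=
  {τ | ∀ i : Fin k, τ ∈ DTW γ (fun ℓ => p ℓ i) (lam i)}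

end TWPaper
namespace TWPaper

theorem Trace.delayedSuffix_mem_TGW {L C : Type} {γ : C} {p : L → ℕ} {lam : ℕ} (hlam : lam ≠ 0)
    (τ : Trace L C) (n : ℕ) (d : ℝ≥0) (h : τ.suffix n ∈ TGW γ p lam) :
    τ.delayedSuffix n d ∈ TGW γ p lam := by
  obtain ⟨j, hj, hlt⟩ := h
  have hloc : ∀ k, ((τ.delayedSuffix n d).st k).1 = ((τ.suffix n).st k).1 := fun k ↦ by
    by_cases hk : k = 0 <;> simp [Trace.suffix, Trace.delayedSuffix, hk]
  refine ⟨j, by simpa only [minPrioIcc, hloc] using hj, ?_⟩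
  rcases Nat.eq_zero_or_pos j with rfl | hpos
  · simpa using Nat.pos_of_ne_zero hlam
  · refine lt_of_le_of_lt ?_ hlt
    simpa [Trace.suffix, Trace.delayedSuffix, hpos.ne', shift] using
      tsub_le_tsub_left (le_self_add : (τ.st n).2 γ ≤ (τ.st n).2 γ + d) ((τ.st (n + j)).2 γ)

/-- For every infinite play `π` of a timed game `G` with priority
function `p : L → {0,…,d-1}` and window bound `λ ∈ ℕ∖{0}`, and every `n`:
the suffix `π_{n→}` is in `TGW(p,λ)` iff for all `d ∈ [0, d_n]` the delayed
suffix `π_{n→}^{+d}` is in `TGW(p,λ)`.  Consequently, `π ∈ DTW(p,λ)` iff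
`π_{n→} ∈ TGW(p,λ)` for all `n`. -/
theorem statement0 {L C Act : Type} [Finite L] [Finite C] [Finite Act]
    (G : TG L C Act) (hwf : G.ta.WellFormed)
    (d : ℕ) (p : L → ℕ) (hp : ∀ ℓ, p ℓ < d)
    (lam : ℕ) (hlam : lam ≠ 0)
    (π : RawPlay L C Act) (hπ : G.IsPlay π) :
    (∀ n : ℕ,
      (π.trace.suffix n ∈ TGW G.ta.gamma p lam ↔
        ∀ dd : ℝ≥0, dd ≤ π.delay n →
          π.trace.delayedSuffix n dd ∈ TGW G.ta.gamma p lam)) ∧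
    (π.trace ∈ DTW G.ta.gamma p lam ↔
      ∀ n : ℕ, π.trace.suffix n ∈ TGW G.ta.gamma p lam) := by
  have key := fun n dd ↦ π.trace.delayedSuffix_mem_TGW (γ := G.ta.gamma) (p := p) hlam n dd
  exact ⟨fun n ↦ ⟨fun h dd _ ↦ key n dd h, fun h ↦ h 0 zero_le⟩,
    fun h n ↦ h n 0 zero_le, fun h n dd _ ↦ key n dd (h n)⟩

end TWPaper
end

section
/- Inductive property of windows: let π = (ℓ_0,ν_0)(m_0^(1),m_0^(2))(ℓ_1,ν_1)… be an infinite play of a timed game with priority function p and bound λ ∈ ℕ∖{0}, and let n ∈ ℕ. If the window opened at step n closes at step j (i.e., min_{n≤k≤j} p(ℓ_k) is even and min_{n≤k≤j'} p(ℓ_k) is odd for all n ≤ j' < j) and ν_j(γ) − ν_n(γ) < λ, then for all i with n ≤ i ≤ j, the suffix π_{i→} belongs to TGW(p,λ). -/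
open scoped NNReal

namespace TWPaper

theorem TA.Trans.gamma_le {L C Act : Type} {A : TA L C Act} (hA : A.WellFormed)
    {s s' : L × Val C} {m : Mv Act} (h : A.Trans s m s') : s.2 A.gamma ≤ s'.2 A.gamma := by
  obtain ⟨-, h⟩ := h
  split at h
  · rw [h.2]
    exact le_self_add
  · obtain ⟨e, he, -, -, -, -, hs, -⟩ := h
    rw [hs, resetV, if_neg (hA.1 e he)]
    exact le_self_add

theorem TG.IsPlay.gamma_monotone {L C Act : Type} {G : TG L C Act} (hG : G.ta.WellFormed)
    {π : RawPlay L C Act} (hπ : G.IsPlay π) : Monotone fun n => (π.s n).2 G.ta.gamma := by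
  refine monotone_nat_of_le_succ fun n => ?_
  rcases (hπ n).2.2 with ⟨-, h⟩ | ⟨-, h⟩ | ⟨-, h | h⟩ <;> exact h.gamma_le hG

theorem minPrioIcc_eq_min {L C : Type} (p : L → ℕ) (τ : Trace L C) {a b c : ℕ}
    (hab : a ≤ b) (hbc : b < c) :
    minPrioIcc p τ a c = min (minPrioIcc p τ a b) (minPrioIcc p τ (b + 1) c) := by
  have hunion : Set.Icc a c = Set.Icc a b ∪ Set.Icc (b + 1) c := by
    ext k
    simp only [Set.mem_Icc, Set.mem_union]
    omega
  unfold minPrioIcc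
  rw [hunion, Set.image_union]
  exact csInf_union (OrderBot.bddBelow _) ((Set.nonempty_Icc.2 hab).image _)
    (OrderBot.bddBelow _) ((Set.nonempty_Icc.2 hbc).image _)

theorem shift_zero {C : Type} (ν : Val C) : shift ν 0 = ν :=
  funext fun x => add_zero (ν x)

theorem Trace.suffix_st {L C : Type} (τ : Trace L C) (i k : ℕ) :
    (τ.suffix i).st k = τ.st (i + k) := by
  rcases k with _ | k
  · simp [Trace.suffix, Trace.delayedSuffix, shift_zero]
  · simp [Trace.suffix, Trace.delayedSuffix]

theorem minPrioIcc_suffix {L C : Type} (p : L → ℕ) (τ : Trace L C) (i a b : ℕ) :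
    minPrioIcc p (τ.suffix i) a b = minPrioIcc p τ (i + a) (i + b) := by
  unfold minPrioIcc
  rw [← Set.image_const_add_Icc, Set.image_image]
  simp only [Trace.suffix_st]

/-- If a window opened at `n` closes at `j`, the window opened at any step in between is
even at `j`. -/
theorem even_minPrioIcc_of_closes {L C : Type} {p : L → ℕ} {τ : Trace L C} {n i j : ℕ}
    (hclose : Even (minPrioIcc p τ n j))
    (hopen : ∀ j', n ≤ j' → j' < j → Odd (minPrioIcc p τ n j'))
    (hni : n ≤ i) (hij : i ≤ j) : Even (minPrioIcc p τ i j) := by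
  rcases hni.eq_or_lt with rfl | hlt
  · exact hclose
  obtain ⟨i, rfl⟩ : ∃ k, i = k + 1 := ⟨i - 1, by omega⟩
  have hodd := hopen i (by omega) (by omega)
  rw [minPrioIcc_eq_min p τ (b := i) (by omega) (by omega)] at hclose
  rcases min_choice (minPrioIcc p τ n i) (minPrioIcc p τ (i + 1) j) with h | h <;>
    rw [h] at hclose
  · exact absurd hclose (Nat.not_even_iff_odd.2 hodd)
  · exact hclose

/-- inductive property of windows.  If the window opened at
step `n` of a play `π` closes at step `j` (the minimum priority over `[n, j]`
is even, while the minimum over `[n, j']` is odd for every `n ≤ j' < j`) and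
less than `λ` time units elapse between steps `n` and `j`, then the suffix
`π_{i→}` belongs to `TGW(p, λ)` for every `n ≤ i ≤ j`. -/
theorem statement1 {L C Act : Type} [Finite L] [Finite C] [Finite Act]
    (G : TG L C Act) (hwf : G.ta.WellFormed)
    (d : ℕ) (p : L → ℕ) (hp : ∀ ℓ, p ℓ < d)
    (lam : ℕ) (hlam : lam ≠ 0)
    (π : RawPlay L C Act) (hπ : G.IsPlay π)
    (n j : ℕ) (hnj : n ≤ j)
    (hclose : Even (minPrioIcc p π.trace n j))
    (hopen : ∀ j', n ≤ j' → j' < j → Odd (minPrioIcc p π.trace n j'))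
    (hsize : (π.s j).2 G.ta.gamma - (π.s n).2 G.ta.gamma < (lam : ℝ≥0)) :
    ∀ i, n ≤ i → i ≤ j → π.trace.suffix i ∈ TGW G.ta.gamma p lam := by
  intro i hni hij
  refine ⟨j - i, ?_, ?_⟩
  · rw [minPrioIcc_suffix, add_zero, Nat.add_sub_cancel' hij]
    exact even_minPrioIcc_of_closes hclose hopen hni hij
  · rw [Trace.suffix_st, Trace.suffix_st, add_zero, Nat.add_sub_cancel' hij]
    exact (tsub_le_tsub_left (hπ.gamma_monotone hwf hni) _).trans_lt hsize

end TWPaper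
end

section
/- For any timed game G with priority function p : L → {0,…,d−1} and any bound λ ∈ ℕ∖{0}: every play of G satisfying the direct timed window objective DTW(p,λ) satisfies the parity objective Parity(p), and every play satisfying the timed window objective TW(p,λ) satisfies Parity(p). -/
open scoped NNReal

namespace TWPaper

open Filter

/-- A sequence of naturals in which every index starts a window whose minimum is even has
an even limit inferior. -/
theorem even_liminf_of_forall_exists_even_sInf {u : ℕ → ℕ} {d : ℕ} (hu : ∀ n, u n < d)
    (h : ∀ n, ∃ j, Even (sInf (u '' Set.Icc n (n + j)))) :
    Even (liminf u atTop) := by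
  have hco : IsCoboundedUnder (· ≥ ·) atTop u :=
    (isBoundedUnder_of ⟨d, fun n => (hu n).le⟩ : IsBoundedUnder (· ≤ ·) atTop u).isCoboundedUnder_ge
  have hbdd : IsBoundedUnder (· ≥ ·) atTop u := isBoundedUnder_of ⟨0, fun n => Nat.zero_le _⟩
  have hge : ∀ᶠ n in atTop, liminf u atTop ≤ u n := by
    rcases Nat.eq_zero_or_pos (liminf u atTop) with h0 | h0
    · simp [h0]
    · filter_upwards [eventually_lt_of_lt_liminf (Nat.sub_lt h0 one_pos) hbdd] with n hn
      omega
  have hle : ∃ᶠ n in atTop, u n < liminf u atTop + 1 :=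
    frequently_lt_of_liminf_lt hco (Nat.lt_succ_self _)
  obtain ⟨M, hM⟩ := eventually_atTop.1 hge
  obtain ⟨n, hn, hun⟩ := frequently_atTop.1 hle M
  obtain ⟨j, hj⟩ := h n
  have hmin : sInf (u '' Set.Icc n (n + j)) = liminf u atTop := by
    have hmem : u n ∈ u '' Set.Icc n (n + j) := ⟨n, ⟨le_rfl, Nat.le_add_right _ _⟩, rfl⟩
    refine le_antisymm ((Nat.sInf_le hmem).trans (Nat.lt_succ_iff.1 hun)) ?_
    refine le_csInf ⟨_, hmem⟩ ?_
    rintro _ ⟨k, hk, rfl⟩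
    exact hM k (hn.trans hk.1)
  rwa [hmin] at hj

theorem Trace.delayedSuffix_st_fst {L C : Type} (τ : Trace L C) (n : ℕ) (d : ℝ≥0) (k : ℕ) :
    ((τ.delayedSuffix n d).st k).1 = (τ.st (n + k)).1 := by
  by_cases hk : k = 0 <;> simp [Trace.delayedSuffix, hk]

theorem exists_even_sInf_of_mem_DTW {L C : Type} {γ : C} {p : L → ℕ} {lam : ℕ} {τ : Trace L C}
    (h : τ ∈ DTW γ p lam) (n : ℕ) :
    ∃ j, Even (sInf ((fun k => p (τ.st k).1) '' Set.Icc n (n + j))) := by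
  obtain ⟨j, hj, -⟩ := h n 0 zero_le
  refine ⟨j, ?_⟩
  have hIcc : Set.Icc n (n + j) = (fun k => n + k) '' Set.Icc 0 j := by simp
  simpa only [minPrioIcc, Trace.delayedSuffix_st_fst, hIcc, Set.image_image] using hj

theorem DTW_subset_ParityObj {L C : Type} {γ : C} {p : L → ℕ} {d lam : ℕ} (hp : ∀ ℓ, p ℓ < d) :
    DTW γ p lam ⊆ ParityObj p := fun _ h =>
  even_liminf_of_forall_exists_even_sInf (fun _ => hp _)
    (exists_even_sInf_of_mem_DTW h)

theorem suffix_mem_ParityObj_iff {L C : Type} {p : L → ℕ} {τ : Trace L C} {n : ℕ} :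
    τ.suffix n ∈ ParityObj p ↔ τ ∈ ParityObj p := by
  simp only [ParityObj, Set.mem_ofPred_eq, Trace.suffix, Trace.delayedSuffix_st_fst, add_comm n]
  rw [liminf_nat_add (fun k => p (τ.st k).1) n]

theorem TW_subset_ParityObj {L C : Type} {γ : C} {p : L → ℕ} {d lam : ℕ} (hp : ∀ ℓ, p ℓ < d) :
    TW γ p lam ⊆ ParityObj p := fun _ ⟨_, h⟩ =>
  suffix_mem_ParityObj_iff.1 (DTW_subset_ParityObj hp h)

/-- Every play of a timed game satisfying the direct timed
window objective `DTW(p,λ)` satisfies the parity objective `Parity(p)`, and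
every play satisfying the timed window objective `TW(p,λ)` satisfies
`Parity(p)`. -/
theorem statement2 {L C Act : Type} [Finite L] [Finite C] [Finite Act]
    (G : TG L C Act) (hwf : G.ta.WellFormed)
    (d : ℕ) (p : L → ℕ) (hp : ∀ ℓ, p ℓ < d)
    (lam : ℕ) (hlam : lam ≠ 0)
    (π : RawPlay L C Act) (hπ : G.IsPlay π) :
    (π.trace ∈ DTW G.ta.gamma p lam → π.trace ∈ ParityObj p) ∧
    (π.trace ∈ TW G.ta.gamma p lam → π.trace ∈ ParityObj p) :=
  ⟨fun h => DTW_subset_ParityObj hp h, fun h => TW_subset_ParityObj hp h⟩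

end TWPaper
end

section
/- Window objectives strictly refine parity: there exist a timed automaton A (with three locations ℓ_0, ℓ_1, ℓ_2, one clock x besides γ, invariants x ≤ 2 on ℓ_0 and ℓ_2 and true on ℓ_1, edges ℓ_0 → ℓ_1 with guard true and no reset, ℓ_1 → ℓ_2 and ℓ_2 → ℓ_0 both with guard true resetting x, all on one action a) and priority function p with p(ℓ_0) = 1, p(ℓ_1) = 2, p(ℓ_2) = 0 such that every time-divergent path of A satisfies the parity objective Parity(p), yet there exists a single time-divergent initial path π of A such that for every λ ∈ ℕ∖{0}, π does not satisfy TW(p,λ) (and hence does not satisfy DTW(p,λ)). -/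
open scoped NNReal

namespace TWPaper

/-! ### The three-location automaton -/

/-- The automaton cycling through `0 → 1 → 2 → 0`, with clock `0` bounded by `2` in the
locations `0` and `2`. -/
def cycleTA : TA (Fin 3) (Fin 2) Unit where
  init := 0
  gamma := 1
  inv := ![[⟨0, Cmp.le, 2⟩], [], [⟨0, Cmp.le, 2⟩]]
  edges := {⟨0, [], (), ∅, 1⟩, ⟨1, [], (), {0}, 2⟩, ⟨2, [], (), {0}, 0⟩}

/-- The priorities of the locations of `cycleTA`. -/
def cyclePrio : Fin 3 → ℕ := ![1, 2, 0]

theorem cycleTA_wellFormed : cycleTA.WellFormed := by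
  refine ⟨?_, ?_⟩
  · rintro e (rfl | rfl | rfl) <;> simp [cycleTA]
  · rintro e (rfl | rfl | rfl) e' (rfl | rfl | rfl) h <;> simp_all

theorem cycleTA_trans_loc {s s' : Fin 3 × Val (Fin 2)} {m : Mv Unit}
    (h : cycleTA.Trans s m s') :
    (s'.1 = s.1 ∧ s'.2 = shift s.2 m.1) ∨ s'.1 = s.1 + 1 := by
  obtain ⟨d, _ | a⟩ := m
  · exact Or.inl h.2
  · obtain ⟨-, e, (rfl | rfl | rfl), hs, -, -, ht, -⟩ := h <;> right <;> rw [ht, ← hs] <;> rfl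

theorem cycleTA_trans_gamma {s s' : Fin 3 × Val (Fin 2)} {m : Mv Unit}
    (h : cycleTA.Trans s m s') : s'.2 1 = s.2 1 + m.1 := by
  obtain ⟨d, _ | a⟩ := m
  · rw [h.2.2]; rfl
  · obtain ⟨-, e, (rfl | rfl | rfl), -, -, -, -, hv, -⟩ := h <;> simp [hv, resetV, shift]

theorem cycleTA_trans_inv {s s' : Fin 3 × Val (Fin 2)} {m : Mv Unit}
    (h : cycleTA.Trans s m s') (hs : s.1 = 0) : s.2 0 + m.1 ≤ 2 := by
  have := h.1
  simpa [hs, cycleTA, satCC, Atom.sat, shift] using this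

/-! ### Time-divergent paths satisfy parity -/

theorem cycleTA_not_timeDiv_of_eventually_zero {π : RawPath (Fin 3) (Fin 2) Unit}
    (hπ : cycleTA.IsPath π) {N : ℕ} (hN : ∀ n ≥ N, (π.s n).1 = 0) :
    ¬ TimeDiv cycleTA.gamma π.trace := by
  intro hdiv
  have hmono : Monotone fun n => (π.s n).2 1 :=
    monotone_nat_of_le_succ fun n => by
      rw [cycleTA_trans_gamma (hπ n)]; exact le_self_add
  have hbound : ∀ k, (π.s (N + k)).2 1 + (π.s N).2 0 = (π.s (N + k)).2 0 + (π.s N).2 1 := by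
    intro k
    induction k with
    | zero => exact add_comm _ _
    | succ k ih =>
      rcases cycleTA_trans_loc (hπ (N + k)) with ⟨-, h⟩ | h
      · rw [← add_assoc, h]
        simp only [shift]
        rw [add_right_comm, ih, add_right_comm]
      · rw [hN _ (by omega), hN _ (by omega)] at h
        exact absurd h (by decide)
  obtain ⟨j, hj⟩ := hdiv (2 + (π.s N).2 1)
  have hj' : 2 + (π.s N).2 1 < (π.s (N + j)).2 1 := hj.trans_le (hmono (by omega))
  have hx : (π.s (N + j)).2 0 ≤ 2 :=
    le_self_add.trans (cycleTA_trans_inv (hπ (N + j)) (hN _ (by omega)))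
  have : (π.s (N + j)).2 1 ≤ 2 + (π.s N).2 1 := by
    calc _ ≤ (π.s (N + j)).2 1 + (π.s N).2 0 := le_self_add
      _ = (π.s (N + j)).2 0 + (π.s N).2 1 := hbound j
      _ ≤ _ := by gcongr
  exact absurd this hj'.not_ge

theorem cycleTA_parity {π : RawPath (Fin 3) (Fin 2) Unit} (hπ : cycleTA.IsPath π)
    (hdiv : TimeDiv cycleTA.gamma π.trace) : π.trace ∈ ParityObj cyclePrio := by
  change Even (Filter.liminf (fun n => cyclePrio (π.s n).1) Filter.atTop)
  by_cases hfreq : ∃ᶠ n in Filter.atTop, (π.s n).1 = 2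
  · have h : Filter.liminf (fun n => cyclePrio (π.s n).1) Filter.atTop ≤ 0 :=
      Filter.liminf_le_of_frequently_le (hfreq.mono fun n hn => by simp [hn, cyclePrio])
        ⟨0, by simp⟩
    rw [Nat.le_zero.mp h]
    exact Even.zero
  obtain ⟨N, hN⟩ := Filter.eventually_atTop.mp (Filter.not_frequently.mp hfreq)
  have hone : ∃ n ≥ N, (π.s n).1 = 1 := by
    by_contra! hne
    refine cycleTA_not_timeDiv_of_eventually_zero hπ (N := N) (fun n hn => ?_) hdiv
    have h1 := hne n hn
    have h2 := hN n hn
    omega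
  obtain ⟨n, hn, h1⟩ := hone
  have hstay : ∀ k ≥ n, (π.s k).1 = 1 := by
    intro k hk
    induction k, hk using Nat.le_induction with
    | base => exact h1
    | succ k hk ih =>
      rcases cycleTA_trans_loc (hπ k) with ⟨h, -⟩ | h
      · exact h.trans ih
      · exact absurd (h.trans (by rw [ih]; rfl)) (hN (k + 1) (by omega))
  have hev : (fun n => cyclePrio (π.s n).1) =ᶠ[Filter.atTop] fun _ => 2 :=
    Filter.eventually_atTop.mpr ⟨n, fun k hk => by simp [hstay k hk, cyclePrio]⟩
  rw [Filter.liminf_congr hev, Filter.liminf_const]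
  exact even_two

theorem Trace.delayedSuffix_zero {L C : Type} (τ : Trace L C) (n : ℕ) :
    τ.delayedSuffix n 0 = ⟨fun k => τ.st (n + k), fun k => τ.dl (n + k)⟩ := by
  simp only [Trace.delayedSuffix, Trace.mk.injEq]
  constructor <;> funext k <;> by_cases hk : k = 0 <;> simp [hk, shift_zero]

theorem TW_subset_suffix_TGW {L C : Type} {γ : C} {p : L → ℕ} {lam : ℕ} {τ : Trace L C}
    (h : τ ∈ TW γ p lam) : ∃ n, ∀ m ≥ n, τ.suffix m ∈ TGW γ p lam := by
  obtain ⟨n, hn⟩ := h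
  refine ⟨n, fun m hm => ?_⟩
  have := hn (m - n) 0 zero_le
  simp only [Trace.suffix, Trace.delayedSuffix_zero] at this ⊢
  simpa only [← add_assoc, Nat.add_sub_cancel' hm] using this

theorem DTW_subset_TW {L C : Type} (γ : C) (p : L → ℕ) (lam : ℕ) :
    DTW γ p lam ⊆ TW γ p lam := fun τ h => by
  refine ⟨0, ?_⟩
  simpa only [Trace.suffix, Trace.delayedSuffix_zero, zero_add] using h

/-! ### A path with ever longer windows -/

/-- The path of `cycleTA` that stays `k` time units in location `1` in its `k`-th cycle and
spends no time elsewhere. -/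
def slowPath : RawPath (Fin 3) (Fin 2) Unit where
  s := fun n => (Fin.ofNat 3 n, ![0, ((∑ i ∈ Finset.range ((n + 1) / 3), i : ℕ) : ℝ≥0)])
  m := fun n => (if n % 3 = 1 then ((n / 3 : ℕ) : ℝ≥0) else 0, some ())

theorem slowPath_zero (k : ℕ) :
    slowPath.s (3 * k) = (0, ![0, ((∑ i ∈ Finset.range k, i : ℕ) : ℝ≥0)]) := by
  have h : (3 * k + 1) / 3 = k := by omega
  simp only [slowPath, h, Prod.mk.injEq, and_true]
  ext; simp

theorem slowPath_one (k : ℕ) :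
    slowPath.s (3 * k + 1) = (1, ![0, ((∑ i ∈ Finset.range k, i : ℕ) : ℝ≥0)]) := by
  have h : (3 * k + 1 + 1) / 3 = k := by omega
  simp only [slowPath, h, Prod.mk.injEq, and_true]
  ext; simp

theorem slowPath_two (k : ℕ) :
    slowPath.s (3 * k + 2) = (2, ![0, ((∑ i ∈ Finset.range (k + 1), i : ℕ) : ℝ≥0)]) := by
  have h : (3 * k + 2 + 1) / 3 = k + 1 := by omega
  simp only [slowPath, h, Prod.mk.injEq, and_true]
  ext; simp

theorem slowPath_isPath : cycleTA.IsPath slowPath := by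
  intro n
  obtain ⟨k, rfl | rfl | rfl⟩ : ∃ k, n = 3 * k ∨ n = 3 * k + 1 ∨ n = 3 * k + 2 :=
    ⟨n / 3, by omega⟩
  · have hm : slowPath.m (3 * k) = (0, some ()) := by simp [slowPath]
    rw [hm, slowPath_zero, slowPath_one]
    refine ⟨by simp [cycleTA, satCC, Atom.sat, shift], ⟨0, [], (), ∅, 1⟩, by simp [cycleTA],
      rfl, rfl, by simp [satCC], rfl, ?_, by simp [cycleTA, satCC]⟩
    funext x; fin_cases x <;> simp [resetV, shift]
  · have h : (3 * k + 1) / 3 = k := by omega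
    have hm : slowPath.m (3 * k + 1) = ((k : ℝ≥0), some ()) := by simp [slowPath, h]
    rw [hm, slowPath_one, slowPath_two]
    refine ⟨by simp [cycleTA, satCC], ⟨1, [], (), {0}, 2⟩, by simp [cycleTA],
      rfl, rfl, by simp [satCC], rfl, ?_, by simp [cycleTA, satCC, Atom.sat]⟩
    funext x; fin_cases x <;> simp [resetV, shift, Finset.sum_range_succ]
  · have hm : slowPath.m (3 * k + 2) = (0, some ()) := by simp [slowPath]
    rw [hm, slowPath_two, show 3 * k + 2 + 1 = 3 * (k + 1) by ring, slowPath_zero]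
    refine ⟨by simp [cycleTA, satCC, Atom.sat, shift], ⟨2, [], (), {0}, 0⟩, by simp [cycleTA],
      rfl, rfl, by simp [satCC], rfl, ?_, by simp [cycleTA, satCC, Atom.sat]⟩
    funext x; fin_cases x <;> simp [resetV, shift]

theorem slowPath_timeDiv : TimeDiv 1 slowPath.trace := by
  intro B
  obtain ⟨k, hk⟩ := exists_nat_gt B
  refine ⟨3 * k + 2, hk.trans_le ?_⟩
  change _ ≤ (slowPath.s (3 * k + 2)).2 1
  rw [slowPath_two]
  simp [Finset.sum_range_succ]

theorem slowPath_suffix_notMem_TGW {k lam : ℕ} (hk : lam ≤ k) :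
    slowPath.trace.suffix (3 * k) ∉ TGW 1 cyclePrio lam := by
  rw [Trace.suffix, Trace.delayedSuffix_zero]
  rintro ⟨j, heven, hlt⟩
  by_cases hj : 2 ≤ j
  · refine absurd hlt (not_lt.mpr ?_)
    change _ ≤ (slowPath.s (3 * k + j)).2 1 - (slowPath.s (3 * k)).2 1
    have hsum : k + ∑ i ∈ Finset.range k, i ≤ ∑ i ∈ Finset.range ((3 * k + j + 1) / 3), i := by
      rw [add_comm, ← Finset.sum_range_succ (fun i => i)]
      exact Finset.sum_le_sum_of_subset (Finset.range_mono (by omega))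
    have hle : (k : ℝ≥0) + ((∑ i ∈ Finset.range k, i : ℕ) : ℝ≥0) ≤ (slowPath.s (3 * k + j)).2 1 := by
      change _ ≤ ((∑ i ∈ Finset.range ((3 * k + j + 1) / 3), i : ℕ) : ℝ≥0)
      exact_mod_cast hsum
    rw [slowPath_zero]
    exact (Nat.cast_le.mpr hk).trans (le_tsub_of_add_le_right hle)
  · have hmin : minPrioIcc cyclePrio ⟨fun i => slowPath.trace.st (3 * k + i),
        fun i => slowPath.trace.dl (3 * k + i)⟩ 0 j = 1 := by
      refine IsLeast.csInf_eq ⟨⟨0, by simp, ?_⟩, ?_⟩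
      · change cyclePrio (slowPath.s (3 * k)).1 = 1
        rw [slowPath_zero]; rfl
      · rintro _ ⟨i, hi, rfl⟩
        change 1 ≤ cyclePrio (slowPath.s (3 * k + i)).1
        obtain rfl | rfl : i = 0 ∨ i = 1 := by have := hi.2; omega
        · rw [add_zero, slowPath_zero]; simp [cyclePrio]
        · rw [slowPath_one]; simp [cyclePrio]
    rw [hmin] at heven
    exact absurd heven (by decide)

theorem slowPath_notMem_TW (lam : ℕ) : slowPath.trace ∉ TW 1 cyclePrio lam := by
  intro h
  obtain ⟨n, hn⟩ := TW_subset_suffix_TGW h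
  exact slowPath_suffix_notMem_TGW (Nat.le_add_left lam n) (hn (3 * (n + lam)) (by omega))

/-- Window objectives strictly refine parity: there is a timed
automaton `A` (three locations `ℓ₀, ℓ₁, ℓ₂`, one clock `x` besides `γ`,
invariants `x ≤ 2` on `ℓ₀` and `ℓ₂` and `true` on `ℓ₁`, edges
`ℓ₀ → ℓ₁` (guard `true`, no reset), `ℓ₁ → ℓ₂` and `ℓ₂ → ℓ₀` (guard `true`,
resetting `x`), all on a single action) and a priority function `p` with
`p ℓ₀ = 1`, `p ℓ₁ = 2`, `p ℓ₂ = 0`, such that every time-divergent path of `A`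
satisfies `Parity(p)`, yet some single time-divergent initial path `π` violates
`TW(p,λ)` (hence also `DTW(p,λ)`) for every `λ ∈ ℕ∖{0}`.
Locations are `Fin 3`; clocks are `Fin 2` with `x = 0` and `γ = 1`. -/
theorem statement3 :
    ∃ (A : TA (Fin 3) (Fin 2) Unit) (p : Fin 3 → ℕ),
      A.WellFormed ∧ A.init = 0 ∧ A.gamma = 1 ∧
      A.inv 0 = [⟨0, Cmp.le, 2⟩] ∧ A.inv 1 = [] ∧ A.inv 2 = [⟨0, Cmp.le, 2⟩] ∧
      A.edges = {⟨0, [], (), ∅, 1⟩, ⟨1, [], (), {0}, 2⟩, ⟨2, [], (), {0}, 0⟩} ∧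
      p 0 = 1 ∧ p 1 = 2 ∧ p 2 = 0 ∧
      (∀ π : RawPath (Fin 3) (Fin 2) Unit, A.IsPath π →
        TimeDiv A.gamma π.trace → π.trace ∈ ParityObj p) ∧
      (∃ π : RawPath (Fin 3) (Fin 2) Unit, A.IsPath π ∧
        π.s 0 = (A.init, fun _ => 0) ∧ TimeDiv A.gamma π.trace ∧
        ∀ lam : ℕ, lam ≠ 0 →
          π.trace ∉ TW A.gamma p lam ∧ π.trace ∉ DTW A.gamma p lam) := by
  refine ⟨cycleTA, cyclePrio, cycleTA_wellFormed, rfl, rfl, rfl, rfl, rfl, rfl, rfl, rfl, rfl,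
    fun π => cycleTA_parity, slowPath, slowPath_isPath, ?_, slowPath_timeDiv, fun lam _ =>
      ⟨slowPath_notMem_TW lam, fun h => slowPath_notMem_TW lam (DTW_subset_TW _ _ _ h)⟩⟩
  rw [← Nat.mul_zero 3, slowPath_zero]
  refine Prod.ext rfl ?_
  funext x; fin_cases x <;> simp

end TWPaper
end

section
/- For every time-divergent infinite play π of a timed game G with priority function p and bound λ ∈ ℕ∖{0}: π satisfies the direct timed window objective DTW(p,λ) if and only if its expansion Ex(π) satisfies the safety objective Safe(Bad) in the expanded timed game G(p,λ), where Bad = L × {bad}. -/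
open scoped NNReal

namespace TWPaper

theorem TG.JointDest.exists_trans {L C Act : Type} {G : TG L C Act} {s s' : L × Val C}
    {m₁ m₂ : Mv Act} (h : G.JointDest s m₁ m₂ s') :
    ∃ m, m.1 = min m₁.1 m₂.1 ∧ G.ta.Trans s m s' := by
  rcases h with ⟨h, ht⟩ | ⟨h, ht⟩ | ⟨h, ht | ht⟩
  · exact ⟨m₁, (min_eq_left h.le).symm, ht⟩
  · exact ⟨m₂, (min_eq_right h.le).symm, ht⟩
  · exact ⟨m₁, (min_eq_left h.le).symm, ht⟩
  · exact ⟨m₂, (min_eq_right h.ge).symm, ht⟩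

theorem TA.WellFormed.trans_gamma {L C Act : Type} {A : TA L C Act} (hA : A.WellFormed)
    {s s' : L × Val C} {m : Mv Act} (h : A.Trans s m s') :
    s'.2 A.gamma = s.2 A.gamma + m.1 := by
  obtain ⟨t, a⟩ := m
  obtain ⟨-, h⟩ := h
  cases a with
  | none => simp [h.2, shift]
  | some a =>
    obtain ⟨e, he, -, -, -, -, h, -⟩ := h
    simp [h, resetV, hA.1 e he, shift]

theorem expTA_trans_of_even {L C Act : Type} {A : TA L C Act} {d : ℕ} {p : L → ℕ} {lam : ℕ}
    {s s' : ExpLoc L × Val (ExpClock C)} {m : Mv (ExpAct Act)}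
    (h : (expTA A d p lam).Trans s m s') {q : ℕ} (hq : s.1.2 = some q) (hq2 : q % 2 = 0) :
    s'.1 = s.1 ∨ (s'.1.2 = some (p s'.1.1) ∧ s'.2 none = 0) := by
  obtain ⟨t, a⟩ := m
  obtain ⟨-, h⟩ := h
  cases a with
  | none => exact Or.inl h.1
  | some a =>
    obtain ⟨e, he, hsrc, -, -, htgt, hval, -⟩ := h
    rw [← hsrc] at hq
    rcases he with ((⟨q', -, h2, e₀, -, rfl⟩ | ⟨q', -, h2, e₀, -, rfl⟩) |
      ⟨q', -, h2, ℓ, b, rfl⟩) | ⟨ℓ, b, rfl⟩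
    · right
      simp [htgt, hval, resetV]
    · simp at hq; omega
    · simp at hq; omega
    · simp at hq

theorem expTA_trans_of_odd {L C Act : Type} {A : TA L C Act} {d : ℕ} {p : L → ℕ} {lam : ℕ}
    {s s' : ExpLoc L × Val (ExpClock C)} {m : Mv (ExpAct Act)}
    (h : (expTA A d p lam).Trans s m s') {q : ℕ} (hq : s.1.2 = some q) (hq2 : q % 2 = 1)
    (hz : s.2 none + m.1 < (lam : ℝ≥0)) :
    s'.2 none = s.2 none + m.1 ∧ (s'.1 = s.1 ∨ s'.1.2 = some (min q (p s'.1.1))) := by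
  obtain ⟨t, a⟩ := m
  obtain ⟨-, h⟩ := h
  cases a with
  | none => exact ⟨by simp [h.2, shift], Or.inl h.1⟩
  | some a =>
    obtain ⟨e, he, hsrc, -, hg, htgt, hval, -⟩ := h
    rw [← hsrc] at hq
    rcases he with ((⟨q', -, h2, e₀, -, rfl⟩ | ⟨q', -, h2, e₀, -, rfl⟩) |
      ⟨q', -, h2, ℓ, b, rfl⟩) | ⟨ℓ, b, rfl⟩
    · simp at hq; omega
    · simp only [Option.some.injEq] at hq
      subst hq
      simp [htgt, hval, resetV, shift]
    · have := hg ⟨none, Cmp.ge, lam⟩ (by simp)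
      exact absurd hz (not_lt.2 this)
    · simp at hq

/-- The least value of `a` on `{0, …, j}`. -/
noncomputable def prefixMin (a : ℕ → ℕ) (j : ℕ) : ℕ := sInf (a '' Set.Icc 0 j)

theorem prefixMin_zero (a : ℕ → ℕ) : prefixMin a 0 = a 0 := by simp [prefixMin]

theorem prefixMin_succ (a : ℕ → ℕ) (j : ℕ) :
    prefixMin a (j + 1) = min (prefixMin a j) (a (j + 1)) := by
  have h : Set.Icc 0 (j + 1) = insert (j + 1) (Set.Icc 0 j) := by
    ext; simp; omega
  unfold prefixMin
  rw [h, Set.image_insert_eq, csInf_insert (OrderBot.bddBelow _) (Set.Nonempty.image _ ⟨0, by simp⟩), min_comm]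

theorem delayedSuffix_mem_TGW {L C : Type} {γ : C} {p : L → ℕ} {lam : ℕ} {τ : Trace L C} {n : ℕ}
    {t : ℝ≥0} :
    τ.delayedSuffix n t ∈ TGW γ p lam ↔
      ∃ j, Even (prefixMin (fun k => p (τ.st (n + k)).1) j) ∧
        ((τ.delayedSuffix n t).st j).2 γ - ((τ.st n).2 γ + t) < (lam : ℝ≥0) := by
  have h : (fun k => p ((τ.delayedSuffix n t).st k).1) = fun k => p (τ.st (n + k)).1 := by
    funext k
    rcases Nat.eq_zero_or_pos k with rfl | hk
    · simp [Trace.delayedSuffix]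
    · simp [Trace.delayedSuffix, hk.ne']
  simp only [TGW, Set.mem_ofPred_eq, minPrioIcc, h]
  rfl

/-- The evolution of the window priority `q` and of the window clock `z` along a trace, at the
steps where no bad window is detected. -/
structure WindowTracking {L C : Type} (γ : C) (p : L → ℕ) (lam : ℕ) (τ : Trace L C)
    (q : ℕ → ℕ) (z : ℕ → ℝ≥0) : Prop where
  q_zero : q 0 = p (τ.st 0).1
  z_zero : z 0 = 0
  gamma_succ : ∀ n, (τ.st (n + 1)).2 γ = (τ.st n).2 γ + τ.dl n
  even_step : ∀ n, q n % 2 = 0 → (q (n + 1) = q n ∧ (τ.st (n + 1)).1 = (τ.st n).1) ∨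
    (q (n + 1) = p (τ.st (n + 1)).1 ∧ z (n + 1) = 0)
  odd_step : ∀ n, q n % 2 = 1 → z n + τ.dl n < lam → z (n + 1) = z n + τ.dl n ∧
    ((q (n + 1) = q n ∧ (τ.st (n + 1)).1 = (τ.st n).1) ∨
      q (n + 1) = min (q n) (p (τ.st (n + 1)).1))

namespace WindowTracking

variable {L C : Type} {γ : C} {p : L → ℕ} {lam : ℕ} {τ : Trace L C} {q : ℕ → ℕ} {z : ℕ → ℝ≥0}

theorem gamma_mono (h : WindowTracking γ p lam τ q z) : Monotone fun n => (τ.st n).2 γ :=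
  monotone_nat_of_le_succ fun n => by simp [h.gamma_succ n]

theorem q_le (h : WindowTracking γ p lam τ q z) {N : ℕ}
    (hz : ∀ n < N, q n % 2 = 1 → z n + τ.dl n < lam) {n : ℕ} (hn : n ≤ N) :
    q n ≤ p (τ.st n).1 ∧ (q n % 2 = 0 → q n = p (τ.st n).1) := by
  induction n with
  | zero => simp [h.q_zero]
  | succ n ih =>
    obtain ⟨h1, h2⟩ := ih (by omega)
    rcases Nat.mod_two_eq_zero_or_one (q n) with h0 | h0
    · rcases h.even_step n h0 with ⟨ha, hb⟩ | ⟨ha, -⟩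
      · rw [ha, hb]; exact ⟨h1, h2⟩
      · simp [ha]
    · rcases (h.odd_step n h0 (hz n (by omega) h0)).2 with ⟨ha, hb⟩ | ha
      · rw [ha, hb]; exact ⟨h1, h2⟩
      · rw [ha]; omega

theorem q_succ_of_odd (h : WindowTracking γ p lam τ q z) {n : ℕ}
    (hz : ∀ k ≤ n, q k % 2 = 1 → z k + τ.dl k < lam) (hq : q n % 2 = 1) :
    q (n + 1) = min (q n) (p (τ.st (n + 1)).1) := by
  rcases (h.odd_step n hq (hz n le_rfl hq)).2 with ⟨ha, hb⟩ | ha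
  · have := (h.q_le (N := n) (fun k hk => hz k hk.le) le_rfl).1
    rw [ha, hb]; omega
  · exact ha

/-- If no bad window is ever detected on a time-divergent trace, then every window closes
in time. -/
theorem mem_DTW (h : WindowTracking γ p lam τ q z) (hlam : lam ≠ 0) (hdiv : TimeDiv γ τ)
    (hz : ∀ n, q n % 2 = 1 → z n + τ.dl n < lam) : τ ∈ DTW γ p lam := by
  rintro n t -
  rw [delayedSuffix_mem_TGW]
  have hpos : (0 : ℝ≥0) < lam := by exact_mod_cast Nat.pos_of_ne_zero hlam
  set M := prefixMin (fun k => p (τ.st (n + k)).1) with hM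
  have close : ∀ k, Even (M k) → (τ.st (n + k)).2 γ < lam + (τ.st n).2 γ →
      ∃ j, Even (M j) ∧
        ((τ.delayedSuffix n t).st j).2 γ - ((τ.st n).2 γ + t) < (lam : ℝ≥0) := by
    intro k hk hlt
    refine ⟨k, hk, ?_⟩
    rcases Nat.eq_zero_or_pos k with rfl | hk0
    · simpa [Trace.delayedSuffix, shift] using hpos
    · simp only [Trace.delayedSuffix, if_neg hk0.ne']
      rcases le_total ((τ.st (n + k)).2 γ) ((τ.st n).2 γ + t) with hle | hle
      · rwa [tsub_eq_zero_of_le hle]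
      refine (tsub_lt_iff_right hle).2 ?_
      exact hlt.trans_le (by rw [← add_assoc]; exact le_self_add)
  by_contra hno
  have hopen : ∀ k, q (n + k) % 2 = 1 ∧ q (n + k) = min (q n) (M k) ∧
      z (n + k) + (τ.st n).2 γ = z n + (τ.st (n + k)).2 γ := by
    intro k
    induction k with
    | zero =>
      have hle := h.q_le (N := n) (fun k _ => hz k) le_rfl
      have hM0 : M 0 = p (τ.st n).1 := prefixMin_zero _
      refine ⟨?_, by rw [hM0]; exact (min_eq_left hle.1).symm, rfl⟩
      by_contra hq
      have he : q n % 2 = 0 := by simp at hq; omega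
      refine hno (close 0 ?_ (by simpa using hpos))
      rw [hM0, ← hle.2 he]
      exact Nat.even_iff.2 he
    | succ k ih =>
      obtain ⟨hodd, hmin, htime⟩ := ih
      have hq := h.q_succ_of_odd (n := n + k) (fun k _ => hz k) hodd
      have hstep := (h.odd_step _ hodd (hz _ hodd)).1
      have hlt := hz _ hodd
      have hMs : M (k + 1) = min (M k) (p (τ.st (n + (k + 1))).1) := prefixMin_succ _ _
      have hγ := h.gamma_succ (n + k)
      rw [add_assoc] at hq hstep hγ
      have heq : q (n + (k + 1)) = min (q n) (M (k + 1)) := by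
        rw [hq, hmin, hMs, min_assoc]
      have htime' : z (n + (k + 1)) + (τ.st n).2 γ = z n + (τ.st (n + (k + 1))).2 γ := by
        rw [hstep, hγ, ← add_assoc, ← htime]; ring
      refine ⟨?_, heq, htime'⟩
      by_contra he
      have h0 : q n % 2 = 1 := by
        by_contra h0
        have hle := h.q_le (N := n) (fun k _ => hz k) le_rfl
        refine hno (close 0 ?_ (by simpa using hpos))
        rw [hM, prefixMin_zero, Nat.even_iff]
        have := hle.2 (by omega)
        simp only [add_zero]
        omega
      refine hno (close (k + 1) (Nat.even_iff.2 (by omega)) ?_)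
      calc (τ.st (n + (k + 1))).2 γ ≤ z n + (τ.st (n + (k + 1))).2 γ := le_add_self
        _ = z (n + (k + 1)) + (τ.st n).2 γ := htime'.symm
        _ < lam + (τ.st n).2 γ := by
          rw [hstep]
          gcongr
  obtain ⟨j, hj⟩ := hdiv (lam + (τ.st n).2 γ)
  have hnj : n ≤ j := by
    by_contra hlt
    have := h.gamma_mono (not_le.1 hlt).le
    exact absurd (hj.trans_le this) (not_lt.2 le_add_self)
  obtain ⟨k, rfl⟩ := Nat.exists_eq_add_of_le hnj
  obtain ⟨hodd, -, htime⟩ := hopen k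
  have hlt : z (n + k) < lam := lt_of_le_of_lt le_self_add (hz _ hodd)
  have : (τ.st (n + k)).2 γ ≤ lam + (τ.st n).2 γ :=
    calc (τ.st (n + k)).2 γ ≤ z n + (τ.st (n + k)).2 γ := le_add_self
      _ = z (n + k) + (τ.st n).2 γ := htime.symm
      _ ≤ lam + (τ.st n).2 γ := by gcongr
  exact absurd hj (not_lt.2 this)

/-- Conversely, no bad window is ever detected along a trace in which all windows close
in time. -/
theorem lt_of_mem_DTW (h : WindowTracking γ p lam τ q z) (hτ : τ ∈ DTW γ p lam) :
    ∀ n, q n % 2 = 1 → z n + τ.dl n < lam := by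
  -- the current window was opened at some step `i`, and has not been closed since
  have key : ∀ n, (∀ k < n, q k % 2 = 1 → z k + τ.dl k < lam) → q n % 2 = 1 →
      ∃ i k, n = i + k ∧ z n + (τ.st i).2 γ = (τ.st n).2 γ ∧
        (∀ j ≤ k, prefixMin (fun k => p (τ.st (i + k)).1) j % 2 = 1) ∧
        prefixMin (fun k => p (τ.st (i + k)).1) k = q n := by
    intro n
    induction n with
    | zero =>
      intro _ hq
      refine ⟨0, 0, rfl, by simp [h.z_zero], fun j hj => ?_, ?_⟩
      · rw [Nat.le_zero.1 hj, prefixMin_zero]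
        simpa [← h.q_zero] using hq
      · simp [prefixMin_zero, h.q_zero]
    | succ n ih =>
      intro hz hq
      rcases Nat.mod_two_eq_zero_or_one (q n) with h0 | h0
      · rcases h.even_step n h0 with ⟨ha, -⟩ | ⟨ha, hb⟩
        · omega
        · refine ⟨n + 1, 0, rfl, by simp [hb], fun j hj => ?_, ?_⟩
          · rw [Nat.le_zero.1 hj, prefixMin_zero]
            simpa [← ha] using hq
          · simp [prefixMin_zero, ha]
      · obtain ⟨i, k, rfl, htime, hodd, hmin⟩ := ih (fun k hk => hz k (by omega)) h0
        have hs := h.q_succ_of_odd (fun k hk => hz k (by omega)) h0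
        have hMs := prefixMin_succ (fun k => p (τ.st (i + k)).1) k
        rw [hmin, ← add_assoc, ← hs] at hMs
        refine ⟨i, k + 1, rfl, ?_, fun j hj => ?_, hMs⟩
        · rw [(h.odd_step _ h0 (hz _ (by omega) h0)).1, h.gamma_succ, ← htime]; ring
        · rcases Nat.le_succ_iff.1 hj with hj | rfl
          · exact hodd j hj
          · exact hMs ▸ hq
  intro n
  induction n using Nat.strong_induction_on with
  | _ n ih =>
    intro hq
    obtain ⟨i, k, rfl, htime, hodd, -⟩ := key n ih hq
    obtain ⟨j, heven, hlt⟩ := delayedSuffix_mem_TGW.1 (hτ i 0 zero_le)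
    have hkj : k < j := by
      by_contra hjk
      have := hodd j (not_lt.1 hjk)
      rw [Nat.even_iff] at heven
      omega
    simp only [Trace.delayedSuffix, if_neg (by omega : ¬ j = 0), add_zero] at hlt
    have hmono := h.gamma_mono (by omega : i + k + 1 ≤ i + j)
    simp only [h.gamma_succ, ← htime] at hmono
    refine lt_of_le_of_lt (le_tsub_of_add_le_right ?_) hlt
    calc z (i + k) + τ.dl (i + k) + (τ.st i).2 γ
        = z (i + k) + (τ.st i).2 γ + τ.dl (i + k) := by ring
      _ ≤ _ := hmono

end WindowTracking

/-- At a step where no bad window is detected, the expansion makes a single step, with the same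
delay. -/
theorem ExStep.of_not_bad {L C Act : Type} {p : L → ℕ} {lam : ℕ} {π : RawPlay L C Act}
    {π' : RawPlay (ExpLoc L) (ExpClock C) (ExpAct Act)} {f : ℕ → ℕ} {n q : ℕ}
    (h : ExStep p lam π π' f n) (hq : (π'.s (f n)).1.2 = some q)
    (hz : q % 2 = 0 ∨ (π'.s (f n)).2 none + π.delay n < (lam : ℝ≥0)) :
    f (n + 1) = f n + 1 ∧ π'.delay (f n) = π.delay n := by
  obtain ⟨q', hq', h⟩ := h
  obtain rfl : q = q' := by simpa [hq] using hq'
  obtain ⟨hf, heven, hodd⟩ := (h _ _ rfl rfl).1 hz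
  refine ⟨hf, ?_⟩
  rcases Nat.mod_two_eq_zero_or_one q with h0 | h0
  · simp [RawPlay.delay, heven h0, liftMove]
  · obtain ⟨h1, h1', h2, h2'⟩ := hodd h0
    have hz' := hz.resolve_left (by omega)
    generalize (π'.s (f n)).2 none = z at *
    simp only [RawPlay.delay] at hz' ⊢
    rcases lt_or_ge (z + (π.m1 n).1) (lam : ℝ≥0) with a | a <;>
      rcases lt_or_ge (z + (π.m2 n).1) (lam : ℝ≥0) with b | b
    · simp [h1 a, h2 b, liftMove]
    · have e1 : (π.m1 n).1 ≤ lam - z := le_tsub_of_add_le_left a.le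
      have e2 : (π.m1 n).1 ≤ (π.m2 n).1 := le_of_add_le_add_left (a.le.trans b)
      simp [h1 a, h2' b, liftMove, betaMv, e1, e2]
    · have e1 : (π.m2 n).1 ≤ lam - z := le_tsub_of_add_le_left b.le
      have e2 : (π.m2 n).1 ≤ (π.m1 n).1 := le_of_add_le_add_left (b.le.trans a)
      simp [h1' a, h2 b, liftMove, betaMv, e1, e2]
    · rcases min_choice (π.m1 n).1 (π.m2 n).1 with e | e <;> rw [e] at hz'
      · exact absurd hz' (not_lt.2 a)
      · exact absurd hz' (not_lt.2 b)

theorem ExStep.exists_bad {L C Act : Type} {p : L → ℕ} {lam : ℕ} {π : RawPlay L C Act}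
    {π' : RawPlay (ExpLoc L) (ExpClock C) (ExpAct Act)} {f : ℕ → ℕ} {n q : ℕ}
    (h : ExStep p lam π π' f n) (hq : (π'.s (f n)).1.2 = some q) (hq2 : q % 2 = 1)
    (hz : (lam : ℝ≥0) ≤ (π'.s (f n)).2 none + π.delay n) :
    (π'.s (f n + 1)).1 ∈ BadLocs L := by
  obtain ⟨q', hq', h⟩ := h
  obtain rfl : q = q' := by simpa [hq] using hq'
  obtain ⟨μ, hμ, -, -, -, hbad, -⟩ := (h _ _ rfl rfl).2 hq2 hz
  have := hbad 0 hμ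
  simp only [mul_zero, add_zero] at this
  simp [BadLocs, this]

/-- For every time-divergent play `π` of `G`:
`π ∈ DTW(p,λ)` iff its expansion satisfies the safety objective `Safe(Bad)`
in the expanded game `G(p,λ)`, where `Bad = L × {bad}`. -/
theorem statement5 {L C Act : Type} [Finite L] [Finite C] [Finite Act]
    (G : TG L C Act) (hwf : G.ta.WellFormed)
    (d : ℕ) (p : L → ℕ) (hp : ∀ ℓ, p ℓ < d)
    (lam : ℕ) (hlam : lam ≠ 0)
    (π : RawPlay L C Act) (hπ : G.IsPlay π)
    (hdiv : TimeDiv G.ta.gamma π.trace)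
    (π' : RawPlay (ExpLoc L) (ExpClock C) (ExpAct Act))
    (hex : IsExpansion G d p lam π π') :
    π.trace ∈ DTW G.ta.gamma p lam ↔ π'.trace ∈ SafeObj (BadLocs L) := by
  obtain ⟨hplay, f, hf0, -, hq0, hz0, hs, hstep⟩ := hex
  choose q hq using fun n => Option.ne_none_iff_exists'.1 (hs n).2.1
  set z : ℕ → ℝ≥0 := fun n => (π'.s (f n)).2 none with hz
  have htrans : ∀ n, (q n % 2 = 0 ∨ z n + π.delay n < (lam : ℝ≥0)) →
      ∃ m, m.1 = π.delay n ∧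
        (expTA G.ta d p lam).Trans (π'.s (f n)) m (π'.s (f (n + 1))) := by
    intro n h
    obtain ⟨hf, hd⟩ := (hstep n).of_not_bad (hq n) h
    obtain ⟨m, hm, ht⟩ := (hplay (f n)).2.2.exists_trans
    exact ⟨m, hm.trans hd, hf ▸ ht⟩
  have hloc : ∀ n, (π'.s (f (n + 1))).1 = (π'.s (f n)).1 →
      q (n + 1) = q n ∧ (π.s (n + 1)).1 = (π.s n).1 := by
    intro n h
    refine ⟨?_, by rw [← (hs n).1, ← (hs (n + 1)).1, h]⟩
    have := hq (n + 1)
    rw [h, hq n] at this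
    exact (Option.some.inj this).symm
  have hw : WindowTracking G.ta.gamma p lam π.trace q z := by
    refine ⟨?_, by simp [hz, hf0, hz0], fun n => ?_, fun n h => ?_, fun n h hlt => ?_⟩
    · have := hq 0
      rw [hf0, hq0] at this
      exact (Option.some.inj this).symm
    · obtain ⟨m, hm, ht⟩ := (hπ n).2.2.exists_trans
      have := hwf.trans_gamma ht
      rw [hm] at this
      exact this
    · obtain ⟨m, hm, ht⟩ := htrans n (Or.inl h)
      rcases expTA_trans_of_even ht (hq n) h with h | ⟨h, h'⟩
      · exact Or.inl (hloc n h)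
      · rw [hq (n + 1), (hs (n + 1)).1] at h
        exact Or.inr ⟨Option.some.inj h, h'⟩
    · obtain ⟨m, hm, ht⟩ := htrans n (Or.inr hlt)
      obtain ⟨h1, h2⟩ := expTA_trans_of_odd ht (hq n) h (by rw [hm]; exact hlt)
      refine ⟨by rw [hm] at h1; exact h1, ?_⟩
      rcases h2 with h | h
      · exact Or.inl (hloc n h)
      · rw [hq (n + 1), (hs (n + 1)).1] at h
        exact Or.inr (Option.some.inj h)
  constructor
  · intro h n
    have hlt := hw.lt_of_mem_DTW h
    have hf : ∀ n, f n = n := by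
      intro n
      induction n with
      | zero => exact hf0
      | succ n ih =>
        have := ((hstep n).of_not_bad (hq n) ((Nat.mod_two_eq_zero_or_one _).imp_right (hlt n))).1
        rw [this, ih]
    have := (hs n).2.1
    rw [hf] at this
    exact this
  · intro h
    refine hw.mem_DTW hlam hdiv fun n hodd => ?_
    by_contra hlt
    exact h _ ((hstep n).exists_bad (hq n) hodd (not_lt.1 hlt))

end TWPaper
end
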